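/- There exists a compact metric space K with dim_T K = ∞ such that for every positive integer n and every f ∈ C(K,ℝⁿ) there is a point y_f ∈ ℝⁿ with dim_T f⁻¹(y) < ∞ for all y ∈ ℝⁿ ∖ {y_f}. -/

import Mathlib

open Set Metric Filter Topology TopologicalSpace
open scoped ENNReal NNReal

noncomputable section

universe u

/-- `indBelow n X` means that the small inductive (topological) dimension of `X`
is at most `n - 1`; in particular `indBelow 0 X` means `X = ∅`. -/
def indBelow : ℕ → ∀ (X : Type u) [TopologicalSpace X], Prop
  | 0, X, _ => IsEmpty X
  | n + 1, X, inst =>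
      letI := inst
      ∀ (x : X) (U : Set X), IsOpen U → x ∈ U →
        ∃ V : Set X, IsOpen V ∧ x ∈ V ∧ V ⊆ U ∧ indBelow n ↥(frontier V)

/-- The small inductive (topological) dimension, with values in `EReal`:
`-1` for the empty space and `⊤` if there is no finite bound. -/
def indDim (X : Type u) [TopologicalSpace X] : EReal :=
  sInf {d : EReal | ∃ n : ℕ, indBelow n X ∧ d = (n : EReal) - 1}

variable {X : Type u} [MetricSpace X]

/-- Topological dimension of a subset of a metric space. -/
def tdim (A : Set X) : EReal := indDim ↥A

open Classical in
/-- Hausdorff dimension of a subset of a metric space,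
with the convention `dim ∅ = -1`. -/
def hdim (A : Set X) : EReal := if A = ∅ then -1 else ((dimH A : ℝ≥0∞) : EReal)

/-- A `δ`-packing of `A`: a countable family of pairwise disjoint closed balls
with centers in `A` and radii at most `δ`. -/
def IsPacking (A : Set X) (δ : ℝ≥0) (s : Set (X × ℝ≥0)) : Prop :=
  s.Countable ∧ (∀ p ∈ s, p.1 ∈ A ∧ p.2 ≤ δ) ∧
    s.Pairwise fun p q => Disjoint (closedBall p.1 (p.2 : ℝ)) (closedBall q.1 (q.2 : ℝ))

/-- The packing pre-measure `P^h_δ(A)`. -/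
def packPre (h : ℝ≥0 → ℝ≥0) (A : Set X) (δ : ℝ≥0) : ℝ≥0∞ :=
  ⨆ (s : Set (X × ℝ≥0)) (_ : IsPacking A δ s), ∑' p : s, ((h p.1.2 : ℝ≥0) : ℝ≥0∞)

/-- The packing pre-measure (packing number) `P^h₀(A) = lim_{δ → 0+} P^h_δ(A)`. -/
def packPre0 (h : ℝ≥0 → ℝ≥0) (A : Set X) : ℝ≥0∞ :=
  ⨅ (δ : ℝ≥0) (_ : 0 < δ), packPre h A δ

/-- The `h`-packing measure `𝒫^h(A)`. -/
def packMeasure (h : ℝ≥0 → ℝ≥0) (A : Set X) : ℝ≥0∞ :=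
  ⨅ (c : ℕ → Set X) (_ : A = ⋃ i, c i), ∑' i, packPre0 h (c i)

open Classical in
/-- The packing dimension, with the convention `dim ∅ = -1`. -/
def pdim (A : Set X) : EReal :=
  if A = ∅ then -1
  else max 0 (⨆ (s : ℝ≥0) (_ : packMeasure (fun r => r ^ (s : ℝ)) A = ∞), ((s : ℝ) : EReal))

/-- The restriction of the packing measure `𝒫^h` to `A` is σ-finite. -/
def PackSigmaFiniteOn (h : ℝ≥0 → ℝ≥0) (A : Set X) : Prop :=
  ∃ c : ℕ → Set X, A ⊆ ⋃ i, c i ∧ ∀ i, packMeasure h (A ∩ c i) < ∞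

/-- The generalized Hausdorff measure `ℋ^h(A)` associated to a gauge function `h`. -/
def hMeasure (h : ℝ≥0 → ℝ≥0) (A : Set X) : ℝ≥0∞ :=
  ⨆ (δ : ℝ≥0) (_ : 0 < δ),
    ⨅ (c : ℕ → Set X) (_ : A ⊆ ⋃ i, c i) (_ : ∀ i, EMetric.diam (c i) ≤ (δ : ℝ≥0∞)),
      ∑' i, ((h (EMetric.diam (c i)).toNNReal : ℝ≥0) : ℝ≥0∞)

/-- `F` is an `F_σ` subset of the subspace `A`. -/
def IsFSigmaIn (F A : Set X) : Prop :=
  ∃ C : ℕ → Set X, (∀ i, IsClosed (C i)) ∧ F = ⋃ i, C i ∩ A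

/-- `d^n_*(A) = inf {dim_*(A ∖ F) : F ⊆ A is F_σ in A and dim_T F ≤ n - 1}`. -/
def dStar (dim : Set X → EReal) (n : ℕ) (A : Set X) : EReal :=
  sInf {d : EReal |
    ∃ F : Set X, IsFSigmaIn F A ∧ tdim F ≤ (n : EReal) - 1 ∧ d = dim (A \ F)}

end

namespace CubeCochain

variable {V : Type*}

/-- The tuple `p` with its `j`-th entry deleted. -/
def face (j : ℕ) (p : ℕ → V) : ℕ → V := fun l => if l < j then p l else p (l + 1)

lemma face_zero (p : ℕ → V) : face 0 p = fun l => p (l + 1) := by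
  funext l
  simp [face]

/-- The cup product of the 1-cochains in `L`, followed by the cochain `W`. -/
def cupWith (W : (ℕ → V) → ZMod 2) : List (V → V → ZMod 2) → (ℕ → V) → ZMod 2
  | [], p => W p
  | c :: L, p => c (p 0) (p 1) * cupWith W L fun l => p (l + 1)

/-- The cup product of a list of 1-cochains. -/
def cup : List (V → V → ZMod 2) → (ℕ → V) → ZMod 2 := cupWith fun _ => 1

/-- The coboundary of a 0-cochain. -/
def coboundary (u : V → ZMod 2) : V → V → ZMod 2 := fun a b => u a + u b

/-- The 1-cochain `c` satisfies the cocycle identity along the tuple `p`. -/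
def IsCocycleAlong (p : ℕ → V) (c : V → V → ZMod 2) : Prop :=
  ∀ i j k, i ≤ j → j ≤ k → c (p i) (p k) = c (p i) (p j) + c (p j) (p k)

lemma IsCocycleAlong.shift {p : ℕ → V} {c : V → V → ZMod 2} (h : IsCocycleAlong p c) :
    IsCocycleAlong (fun l => p (l + 1)) c :=
  fun i j k hij hjk => h (i + 1) (j + 1) (k + 1) (by lia) (by lia)

lemma isCocycleAlong_coboundary (p : ℕ → V) (u : V → ZMod 2) :
    IsCocycleAlong p (coboundary u) := by
  intro i j k _ _
  have := CharTwo.add_self_eq_zero (u (p j))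
  simp only [coboundary]
  linear_combination -this

lemma IsCocycleAlong.add {p : ℕ → V} {c d : V → V → ZMod 2} (hc : IsCocycleAlong p c)
    (hd : IsCocycleAlong p d) : IsCocycleAlong p (c + d) := by
  intro i j k hij hjk
  simp only [Pi.add_apply, hc i j k hij hjk, hd i j k hij hjk]
  ring

/-- The Leibniz rule for a product of cocycles with an `n`-cochain. -/
lemma sum_cupWith_face (W : (ℕ → V) → ZMod 2) (n : ℕ) (L : List (V → V → ZMod 2))
    (p : ℕ → V) (h : ∀ c ∈ L, IsCocycleAlong p c) :
    ∑ j ∈ Finset.range (L.length + n + 2), cupWith W L (face j p) =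
      cupWith (fun q => ∑ j ∈ Finset.range (n + 2), W (face j q)) L p := by
  induction L generalizing p with
  | nil => simp [cupWith]
  | cons c L ih =>
    have hc : IsCocycleAlong p c := h c (by simp)
    have ih := ih (fun l => p (l + 1)) fun d hd => (h d (by simp [hd])).shift
    rw [Finset.sum_range_succ'] at ih
    have h0 : cupWith W (c :: L) (face 0 p) =
        c (p 1) (p 2) * cupWith W L (face 0 fun l => p (l + 1)) := by
      simp [cupWith, face_zero]
    have h1 : cupWith W (c :: L) (face 1 p) =
        c (p 0) (p 2) * cupWith W L (face 0 fun l => p (l + 1)) := by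
      rw [face_zero]
      simp [cupWith, face]
    have h2 : ∀ j, cupWith W (c :: L) (face (j + 2) p) =
        c (p 0) (p 1) * cupWith W L (face (j + 1) fun l => p (l + 1)) := by
      intro j
      simp only [cupWith]
      congr 2
      funext l
      simp [face]
    rw [show (c :: L).length + n + 2 = L.length + n + 1 + 1 + 1 by simp; ring,
      Finset.sum_range_succ', Finset.sum_range_succ']
    simp only [zero_add, Nat.add_assoc, Nat.reduceAdd] at ih ⊢
    simp only [h0, h1, h2, ← Finset.mul_sum]
    rw [cupWith, ← ih, hc 0 1 2 (by simp) (by simp)]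
    have := CharTwo.add_self_eq_zero
      (c (p 1) (p 2) * cupWith W L (face 0 fun l => p (l + 1)))
    linear_combination this

lemma cupWith_zero (L : List (V → V → ZMod 2)) (p : ℕ → V) :
    cupWith (fun _ => 0) L p = 0 := by
  induction L generalizing p with
  | nil => rfl
  | cons c L ih => simp [cupWith, ih]

lemma sum_cup_face (L : List (V → V → ZMod 2)) (p : ℕ → V)
    (h : ∀ c ∈ L, IsCocycleAlong p c) :
    ∑ j ∈ Finset.range (L.length + 2), cup L (face j p) = 0 := by
  have := sum_cupWith_face (fun _ => 1) 0 L p h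
  simpa [cup, cupWith_zero, Finset.sum_range_succ _ 1, show (1 : ZMod 2) + 1 = 0 from rfl,
    show ((2 : ℕ) : ZMod 2) = 0 from rfl] using this

lemma cupWith_cup (L₁ L₂ : List (V → V → ZMod 2)) (p : ℕ → V) :
    cupWith (cup L₂) L₁ p = cup (L₁ ++ L₂) p := by
  induction L₁ generalizing p with
  | nil => rfl
  | cons c L ih =>
    simp only [cup, cupWith, List.cons_append] at ih ⊢
    rw [ih]

lemma cupWith_congr {W W' : (ℕ → V) → ZMod 2} (L : List (V → V → ZMod 2)) (p : ℕ → V)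
    (h : W (fun l => p (l + L.length)) = W' (fun l => p (l + L.length))) :
    cupWith W L p = cupWith W' L p := by
  induction L generalizing p with
  | nil => simpa [cupWith] using h
  | cons c L ih =>
    rw [cupWith, cupWith, ih]
    simpa [add_assoc] using h

/-- A product of cocycles in which one factor is a coboundary is itself a coboundary. -/
lemma sum_face_eq_cup_coboundary (L₁ L₂ : List (V → V → ZMod 2)) (u : V → ZMod 2) (p : ℕ → V)
    (h₁ : ∀ c ∈ L₁, IsCocycleAlong p c) (h₂ : ∀ c ∈ L₂, IsCocycleAlong p c) :
    ∑ j ∈ Finset.range (L₁.length + L₂.length + 2),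
        cupWith (fun q => u (q 0) * cup L₂ q) L₁ (face j p) =
      cup (L₁ ++ coboundary u :: L₂) p := by
  rw [sum_cupWith_face _ _ _ _ h₁, ← cupWith_cup]
  apply cupWith_congr
  set q : ℕ → V := fun l => p (l + L₁.length)
  have hq : ∀ c ∈ L₂, IsCocycleAlong q c := fun c hc i j k hij hjk =>
    h₂ c hc _ _ _ (by lia) (by lia)
  have h0 := sum_cup_face L₂ q hq
  rw [Finset.sum_range_succ'] at h0 ⊢
  have h1 : ∀ j, face (j + 1) q 0 = q 0 := fun j => by simp [face]
  simp only [h1, face_zero, ← Finset.mul_sum] at h0 ⊢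
  rw [show cup (coboundary u :: L₂) q = (u (q 0) + u (q 1)) * cup L₂ fun l => q (l + 1) from rfl]
  have := CharTwo.add_self_eq_zero (u (q 0) * cup L₂ fun l => q (l + 1))
  simp only [zero_add] at *
  linear_combination u (q 0) * h0 - this

lemma cupWith_congr_of_eqOn {W : (ℕ → V) → ZMod 2} {n : ℕ}
    (hW : ∀ p q : ℕ → V, (∀ l ≤ n, p l = q l) → W p = W q) (L : List (V → V → ZMod 2))
    (p q : ℕ → V) (h : ∀ l ≤ L.length + n, p l = q l) : cupWith W L p = cupWith W L q := by
  induction L generalizing p q with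
  | nil => exact hW p q (by simpa using h)
  | cons c L ih =>
    rw [cupWith, cupWith, h 0 (by simp), h 1 (by simp; lia),
      ih (fun l => p (l + 1)) (fun l => q (l + 1)) fun l hl => h _ (by simp; lia)]

lemma cup_congr_of_eqOn (L : List (V → V → ZMod 2)) (p q : ℕ → V)
    (h : ∀ l ≤ L.length, p l = q l) : cup L p = cup L q :=
  cupWith_congr_of_eqOn (n := 0) (fun _ _ _ => rfl) L p q (by simpa using h)

lemma cup_append_add_cons (L₁ L₂ : List (V → V → ZMod 2)) (c d : V → V → ZMod 2)
    (p : ℕ → V) :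
    cup (L₁ ++ (c + d) :: L₂) p = cup (L₁ ++ c :: L₂) p + cup (L₁ ++ d :: L₂) p := by
  induction L₁ generalizing p with
  | nil => simp [cup, cupWith, add_mul]
  | cons e L ih =>
    simp only [cup, cupWith, List.cons_append] at ih ⊢
    rw [ih, mul_add]

lemma cup_ofFn {n : ℕ} (c : Fin n → V → V → ZMod 2) (p : ℕ → V) :
    cup (List.ofFn c) p = ∏ i, c i (p i) (p (i + 1)) := by
  induction n generalizing p with
  | zero => simp [cup, cupWith]
  | succ n ih =>
    rw [List.ofFn_succ, Fin.prod_univ_succ]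
    have := ih (fun i => c i.succ) fun l => p (l + 1)
    simp only [cup, cupWith] at this ⊢
    simp [this]

section Torus

variable {m N : ℕ}

/-- The vertices of the maximal simplex of the Kuhn triangulation of the discrete torus with base
point `x` and order of directions `π`. -/
def path (x : Fin m → Fin (N + 2)) (π : Equiv.Perm (Fin m)) (l : ℕ) : Fin m → Fin (N + 2) :=
  fun a => x a + if (π a : ℕ) < l then 1 else 0

lemma sum_face_path_eq_zero (F : (ℕ → Fin m → Fin (N + 2)) → ZMod 2)
    (x : Fin m → Fin (N + 2)) {j : ℕ} (hj : 0 < j) (hjm : j < m) :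
    ∑ π : Equiv.Perm (Fin m), F (face j (path x π)) = 0 := by
  have hne : (⟨j - 1, by lia⟩ : Fin m) ≠ ⟨j, hjm⟩ := by simp; lia
  refine Finset.sum_involution
    (fun π _ => Equiv.swap (⟨j - 1, by lia⟩ : Fin m) ⟨j, hjm⟩ * π) ?_ ?_ ?_ ?_
  · intro π _
    have : face j (path x (Equiv.swap (⟨j - 1, by lia⟩ : Fin m) ⟨j, hjm⟩ * π)) =
        face j (path x π) := by
      have key : ∀ l, l ≠ j → path x (Equiv.swap (⟨j - 1, by lia⟩ : Fin m) ⟨j, hjm⟩ * π) l =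
          path x π l := by
        intro l hl
        funext a
        simp only [path, Equiv.Perm.mul_apply, Equiv.swap_apply_def]
        congr 2
        split_ifs with h1 h2
        · simp only [h1, eq_iff_iff]; lia
        · simp only [h2, eq_iff_iff]; lia
        · rfl
      funext l
      simp only [face]
      split_ifs with h
      · exact key l (by lia)
      · exact key (l + 1) (by lia)
    rw [this, CharTwo.add_self_eq_zero]
  · intro π _ _ h
    rw [mul_eq_right, Equiv.swap_eq_one_iff] at h
    exact hne h
  · simp
  · intro π _
    simp [← mul_assoc]

lemma path_rotate (x : Fin (m + 1) → Fin (N + 2)) (π : Equiv.Perm (Fin (m + 1))) {l : ℕ}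
    (hl : l ≤ m) :
    path (x + Pi.single (π.symm 0) 1) ((finRotate (m + 1)).symm * π) l = path x π (l + 1) := by
  funext a
  change x a + (Pi.single (π.symm 0) 1 : Fin (m + 1) → Fin (N + 2)) a +
    (if ((finRotate (m + 1)).symm (π a) : ℕ) < l then 1 else 0) =
      x a + if (π a : ℕ) < l + 1 then 1 else 0
  obtain ⟨b, hb⟩ : ∃ b, b = (finRotate (m + 1)).symm (π a) := ⟨_, rfl⟩
  have hb' : π a = finRotate (m + 1) b := by simp [hb]
  rw [← hb, hb']
  rcases eq_or_ne b (Fin.last m) with h | h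
  · have ha : a = π.symm 0 := by rw [Equiv.eq_symm_apply, hb', h, finRotate_last]
    rw [h, finRotate_last, ← ha]
    simp [hl]
  · have hv := coe_finRotate_of_ne_last h
    have ha : a ≠ π.symm 0 := by
      rw [Ne, Equiv.eq_symm_apply, hb']
      intro h0
      rw [h0] at hv
      simp at hv
    rw [hv, Pi.single_eq_of_ne ha]
    simp

lemma sum_face_zero_eq_sum_face_last (Φ : (ℕ → Fin (m + 1) → Fin (N + 2)) → ZMod 2)
    (hΦ : ∀ p q : ℕ → Fin (m + 1) → Fin (N + 2), (∀ l ≤ m, p l = q l) → Φ p = Φ q) :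
    ∑ x : Fin (m + 1) → Fin (N + 2), ∑ π, Φ (face 0 (path x π)) =
      ∑ x : Fin (m + 1) → Fin (N + 2), ∑ π, Φ (face (m + 1) (path x π)) := by
  symm
  rw [Finset.sum_comm, Finset.sum_comm (f := fun x π => Φ (face 0 (path x π))),
    ← Equiv.sum_comp (Equiv.mulLeft (finRotate (m + 1)).symm)]
  refine Finset.sum_congr rfl fun π _ => ?_
  rw [← Equiv.sum_comp (Equiv.addRight (Pi.single (π.symm 0) 1))]
  refine Finset.sum_congr rfl fun x _ => hΦ _ _ fun l hl => ?_
  have := path_rotate x π hl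
  simp only [face, Equiv.coe_addRight, Equiv.coe_mulLeft, this]
  simp [Nat.lt_succ_of_le hl]

/-- The evaluation of a product of cochains on the fundamental class of the torus. -/
def total (m N : ℕ) (L : List ((Fin m → Fin (N + 2)) → (Fin m → Fin (N + 2)) → ZMod 2)) : ZMod 2 :=
  ∑ x : Fin m → Fin (N + 2), ∑ π, cup L (path x π)

lemma total_coboundary
    (L₁ L₂ : List ((Fin m → Fin (N + 2)) → (Fin m → Fin (N + 2)) → ZMod 2))
    (u : (Fin m → Fin (N + 2)) → ZMod 2)
    (h₁ : ∀ c ∈ L₁, ∀ x π, IsCocycleAlong (path x π) c)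
    (h₂ : ∀ c ∈ L₂, ∀ x π, IsCocycleAlong (path x π) c)
    (hm : L₁.length + L₂.length + 1 = m) :
    total m N (L₁ ++ coboundary u :: L₂) = 0 := by
  obtain ⟨k, rfl⟩ : ∃ k, m = k + 1 := ⟨_, hm.symm⟩
  have hk : L₁.length + L₂.length = k := by lia
  have hΦ := sum_face_zero_eq_sum_face_last (m := k) (N := N)
    (cupWith (fun q => u (q 0) * cup L₂ q) L₁)
    (fun p q h => cupWith_congr_of_eqOn (n := L₂.length)
      (fun p q h => by rw [h 0 (by simp), cup_congr_of_eqOn L₂ p q h]) L₁ p q (by rwa [hk]))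
  have key : ∀ (x : Fin (k + 1) → Fin (N + 2)) π,
      cup (L₁ ++ coboundary u :: L₂) (path x π) = ∑ j ∈ Finset.range (k + 2),
        cupWith (fun q => u (q 0) * cup L₂ q) L₁ (face j (path x π)) := fun x π => by
    rw [← sum_face_eq_cup_coboundary L₁ L₂ u (path x π) (fun c hc => h₁ c hc x π)
      fun c hc => h₂ c hc x π, hk]
  simp only [total, key]
  have hmid : ∀ x : Fin (k + 1) → Fin (N + 2),
      ∑ π : Equiv.Perm (Fin (k + 1)),
        ∑ j ∈ Finset.range (k + 2),
          cupWith (fun q => u (q 0) * cup L₂ q) L₁ (face j (path x π)) =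
      ∑ π, cupWith (fun q => u (q 0) * cup L₂ q) L₁ (face 0 (path x π)) +
      ∑ π, cupWith (fun q => u (q 0) * cup L₂ q) L₁
        (face (k + 1) (path x π)) := by
    intro x
    rw [Finset.sum_comm, Finset.sum_range_succ, Finset.sum_range_succ', Finset.sum_eq_zero]
    · simp
    · intro j hj
      rw [Finset.mem_range] at hj
      exact sum_face_path_eq_zero _ x (by simp) (by lia)
  simp only [hmid, Finset.sum_add_distrib]
  rw [hΦ, CharTwo.add_self_eq_zero]

lemma total_map_add_coboundary
    (Q : List (((Fin m → Fin (N + 2)) → (Fin m → Fin (N + 2)) → ZMod 2) ×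
      ((Fin m → Fin (N + 2)) → ZMod 2)))
    (L : List ((Fin m → Fin (N + 2)) → (Fin m → Fin (N + 2)) → ZMod 2))
    (hL : ∀ c ∈ L, ∀ x π, IsCocycleAlong (path x π) c)
    (hQ : ∀ c ∈ Q, ∀ x π, IsCocycleAlong (path x π) c.1) (hm : L.length + Q.length = m) :
    total m N (L ++ Q.map fun c => c.1 + coboundary c.2) = total m N (L ++ Q.map Prod.fst) := by
  induction Q generalizing L with
  | nil => rfl
  | cons c Q ih =>
    have h0 := ih (L ++ [c.1])
      (by
        intro d hd
        rcases List.mem_append.1 hd with hd | hd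
        · exact hL d hd
        · rw [List.mem_singleton.1 hd]
          exact hQ c (by simp))
      (fun d hd => hQ d (by simp [hd])) (by simp at hm ⊢; lia)
    have h1 := total_coboundary L (Q.map fun c => c.1 + coboundary c.2) c.2 hL
      (by
        intro d hd x π
        obtain ⟨e, he, rfl⟩ := List.mem_map.1 hd
        exact (hQ e (by simp [he]) x π).add (isCocycleAlong_coboundary _ _))
      (by simp at hm ⊢; lia)
    rw [List.append_assoc, List.append_assoc, List.singleton_append, List.singleton_append] at h0
    rw [List.map_cons, List.map_cons, ← h0]
    simp only [total, cup_append_add_cons, Finset.sum_add_distrib] at h1 ⊢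
    rw [h1, add_zero]

/-- The 1-cocycle dual to the hyperplane between the layers `0` and `1` in the direction `i`. -/
def step (i : Fin m) (p q : Fin m → Fin (N + 2)) : ZMod 2 := if p i = 0 ∧ q i = 1 then 1 else 0

lemma step_path (i : Fin m) (x : Fin m → Fin (N + 2)) (π : Equiv.Perm (Fin m)) {l k : ℕ}
    (hlk : l ≤ k) :
    step i (path x π l) (path x π k) = if x i = 0 ∧ l ≤ π i ∧ (π i : ℕ) < k then 1 else 0 := by
  simp only [step, path]
  congr 1
  by_cases h1 : (π i : ℕ) < l <;> by_cases h2 : (π i : ℕ) < k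
  · simp only [h1, h2, if_true, eq_iff_iff]
    constructor
    · rintro ⟨h3, h4⟩
      simp [h3] at h4
    · lia
  · lia
  · simp only [h1, h2, if_true, if_false, add_zero, eq_iff_iff]
    constructor
    · rintro ⟨h3, h4⟩
      exact ⟨h3, by lia, trivial⟩
    · rintro ⟨h3, h4⟩
      simp [h3]
  · simp only [h1, h2, if_false, add_zero, eq_iff_iff]
    constructor
    · rintro ⟨h3, h4⟩
      simp [h3] at h4
    · simp

lemma isCocycleAlong_step (i : Fin m) (x : Fin m → Fin (N + 2)) (π : Equiv.Perm (Fin m)) :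
    IsCocycleAlong (path x π) (step i) := by
  intro a b c hab hbc
  rw [step_path i x π hab, step_path i x π hbc, step_path i x π (hab.trans hbc)]
  by_cases h : x i = 0
  · by_cases h1 : a ≤ (π i : ℕ) <;> by_cases h2 : (π i : ℕ) < b <;>
      by_cases h3 : (π i : ℕ) < c <;> simp [h, h1, h2, h3] <;> lia
  · simp [h]

lemma total_step : total m N (List.ofFn step) = 1 := by
  have key : ∀ (x : Fin m → Fin (N + 2)) π,
      cup (List.ofFn step) (path x π) = if x = 0 ∧ π = 1 then 1 else 0 := by
    intro x π
    rw [cup_ofFn]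
    split_ifs with h
    · refine Finset.prod_eq_one fun i _ => ?_
      rw [step_path _ _ _ (by simp), h.1, h.2]
      simp
    · by_contra h0
      refine h ⟨funext fun i => ?_, Equiv.ext fun i => ?_⟩
      all_goals
        have hi := Finset.prod_ne_zero_iff.1 h0 i (Finset.mem_univ i)
        rw [step_path _ _ _ (by simp)] at hi
        simp only [ne_eq, ite_eq_right_iff, one_ne_zero, imp_false, not_not] at hi
      · exact hi.1
      · exact Fin.ext (by simp; lia)
  simp only [total, key, ite_and]
  simp

lemma exists_path_add_coboundary_ne_zero (u : Fin m → (Fin m → Fin (N + 2)) → ZMod 2) :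
    ∃ (x : Fin m → Fin (N + 2)) (π : Equiv.Perm (Fin m)), ∀ i : Fin m,
      step i (path x π i) (path x π (i + 1)) +
        coboundary (u i) (path x π i) (path x π (i + 1)) ≠ 0 := by
  have h := total_map_add_coboundary (m := m) (N := N)
    (List.ofFn fun i => (step i, u i)) [] (by simp)
    (by
      intro c hc x π
      obtain ⟨i, rfl⟩ := List.mem_ofFn.1 hc
      exact isCocycleAlong_step i x π) (by simp)
  simp only [List.nil_append, List.map_ofFn, Function.comp_def] at h
  rw [total_step] at h
  have h1 : total m N (List.ofFn fun i => step i + coboundary (u i)) ≠ 0 := by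
    rw [h]; exact one_ne_zero
  obtain ⟨x, -, hx⟩ := Finset.exists_ne_zero_of_sum_ne_zero h1
  obtain ⟨π, -, hπ⟩ := Finset.exists_ne_zero_of_sum_ne_zero hx
  rw [cup_ofFn] at hπ
  exact ⟨x, π, fun i => Finset.prod_ne_zero_iff.1 hπ i (Finset.mem_univ i)⟩

/-- A cubical Sperner lemma: if the `i`-th labelling of the grid is `0` on the face `x i = 0` and
`1` on the opposite face, then some simplex has an edge across which the `i`-th labelling
changes, for every `i`. -/
lemma exists_path_ne (h : Fin m → (Fin m → Fin (N + 2)) → ZMod 2)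
    (h0 : ∀ i x, x i = 0 → h i x = 0) (h1 : ∀ i x, x i = Fin.last (N + 1) → h i x = 1) :
    ∃ x : Fin m → Fin (N + 2), ∃ π, (∀ i, x i ≠ Fin.last (N + 1)) ∧
      ∀ i : Fin m, h i (path x π i) ≠ h i (path x π (i + 1)) := by
  set u : Fin m → (Fin m → Fin (N + 2)) → ZMod 2 := fun i x => h i x + if x i = 0 then 0 else 1
    with hu
  obtain ⟨x, π, hx⟩ := exists_path_add_coboundary_ne_zero u
  have hlast : ∀ i, x i ≠ Fin.last (N + 1) := by
    intro i hi
    have hz : ∀ l, u i (path x π l) = 0 := by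
      intro l
      by_cases hl : (π i : ℕ) < l
      · have : path x π l i = 0 := by simp [path, hl, hi]
        simp [hu, h0 i _ this, this]
      · have : path x π l i = Fin.last (N + 1) := by simp [path, hl, hi]
        simp [hu, h1 i _ this, this, show (1 : ZMod 2) + 1 = 0 from rfl]
    refine hx i ?_
    simp only [coboundary, hz]
    rw [step_path _ _ _ (by simp), hi]
    simp
  refine ⟨x, π, hlast, fun i hi => hx i ?_⟩
  simp only [coboundary, hu]
  rw [step_path _ _ _ (by simp), hi]
  have hadd : x i + 1 ≠ 0 := fun h => hlast i (by
    rw [eq_neg_of_add_eq_zero_left h, eq_comm, eq_neg_iff_add_eq_zero, Fin.last_add_one])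
  have h2 := CharTwo.add_self_eq_zero (h i (path x π (i + 1)))
  simp only [path] at h2 ⊢
  by_cases ha : (π i : ℕ) < i <;> by_cases hb : (π i : ℕ) < i + 1 <;> by_cases hc : x i = 0 <;>
    simp [ha, hb, hc, hadd, h2] <;> grind

end Torus

end CubeCochain

/-- The Poincaré–Miranda theorem. -/
lemma exists_mem_cube_eq_zero {m : ℕ} (g : (Fin m → ℝ) → Fin m → ℝ)
    (hg : ContinuousOn g (Icc 0 1)) (h0 : ∀ x ∈ Icc (0 : Fin m → ℝ) 1, ∀ i, x i = 0 → g x i < 0)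
    (h1 : ∀ x ∈ Icc (0 : Fin m → ℝ) 1, ∀ i, x i = 1 → 0 < g x i) :
    ∃ x ∈ Icc (0 : Fin m → ℝ) 1, g x = 0 := by
  by_contra! hne
  obtain ⟨x₀, hx₀, hmin⟩ := isCompact_Icc.exists_isMinOn
    (nonempty_Icc.2 (zero_le_one (α := Fin m → ℝ))) hg.norm
  have hε : 0 < ‖g x₀‖ := norm_pos_iff.2 (hne x₀ hx₀)
  obtain ⟨δ, hδ, hδg⟩ := Metric.uniformContinuousOn_iff.1
    (isCompact_Icc.uniformContinuousOn_of_continuous hg) _ hε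
  obtain ⟨N, hN⟩ := exists_nat_one_div_lt hδ
  set pt : (Fin m → Fin (N + 2)) → Fin m → ℝ := fun v i => ((v i : ℕ) : ℝ) / (N + 1) with hpt
  have hNpos : (0 : ℝ) < N + 1 := by positivity
  have hmem : ∀ v, pt v ∈ Icc (0 : Fin m → ℝ) 1 := by
    refine fun v => ⟨fun i => by simp only [hpt, Pi.zero_apply]; positivity, fun i => ?_⟩
    simp only [hpt, Pi.one_apply]
    rw [div_le_one hNpos]
    exact_mod_cast Nat.le_of_lt_succ (v i).isLt
  obtain ⟨x, π, hx, hπ⟩ := CubeCochain.exists_path_ne (N := N)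
    (fun i v => if 0 < g (pt v) i then 1 else 0)
    (by
      intro i v hv
      have := h0 _ (hmem v) i (by simp [hpt, hv])
      simp [this.le])
    (by
      intro i v hv
      have := h1 _ (hmem v) i (by simp [hpt, hv, hNpos.ne'])
      simp [this])
  have hdist : ∀ l i, |g (pt (CubeCochain.path x π l)) i - g (pt x) i| < ‖g x₀‖ := by
    intro l i
    have hd : dist (pt (CubeCochain.path x π l)) (pt x) < δ := by
      refine (dist_pi_lt_iff hδ).2 fun a => lt_of_le_of_lt ?_ hN
      rw [Real.dist_eq]
      simp only [hpt, CubeCochain.path]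
      split_ifs with h
      · rw [Fin.val_add_one_of_lt (Fin.lt_last_iff_ne_last.2 (hx a)), ← sub_div]
        simp [abs_of_pos hNpos]
      · simp [hNpos.le]
    rw [← Real.dist_eq]
    exact (dist_le_pi_dist _ _ i).trans_lt (hδg _ (hmem _) _ (hmem _) hd)
  have hlt : ‖g (pt x)‖ < ‖g x₀‖ := by
    refine (pi_norm_lt_iff hε).2 fun i => ?_
    have ha := abs_lt.1 (hdist i i)
    have hb := abs_lt.1 (hdist (i + 1) i)
    have hi := hπ i
    rw [Real.norm_eq_abs, abs_lt]
    by_cases h2 : 0 < g (pt (CubeCochain.path x π i)) i <;>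
      by_cases h3 : 0 < g (pt (CubeCochain.path x π (i + 1))) i <;> simp [h2, h3] at hi <;>
      constructor <;> linarith
  exact hlt.not_ge (hmin (hmem x))

/-- Every nonvanishing `ℝᵐ`-valued map on a closed set `A` extends to a nonvanishing map on
`A ∪ S`. -/
def NonvanishingExtension {X : Type*} [TopologicalSpace X] (m : ℕ) (S : Set X) : Prop :=
  ∀ (A : Set X) (f : X → Fin m → ℝ), IsClosed A → ContinuousOn f A → (∀ x ∈ A, f x ≠ 0) →
    ∃ g : X → Fin m → ℝ, ContinuousOn g (A ∪ S) ∧ (∀ x ∈ A ∪ S, g x ≠ 0) ∧ EqOn g f A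

lemma NonvanishingExtension.union {X : Type*} [TopologicalSpace X] {m : ℕ} {S T : Set X}
    (hSc : IsClosed S) (hS : NonvanishingExtension m S) (hT : NonvanishingExtension m T) :
    NonvanishingExtension m (S ∪ T) := by
  intro A f hA hf hf0
  obtain ⟨g, hg, hg0, hgf⟩ := hS A f hA hf hf0
  obtain ⟨k, hk, hk0, hkg⟩ := hT (A ∪ S) g (hA.union hSc) hg hg0
  rw [union_assoc] at hk hk0
  exact ⟨k, hk, hk0, (hkg.mono subset_union_left).trans hgf⟩

lemma NonvanishingExtension.biUnion {X ι : Type*} [TopologicalSpace X] {m : ℕ} (s : Finset ι)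
    {S : ι → Set X} (hc : ∀ i ∈ s, IsClosed (S i))
    (h : ∀ i ∈ s, NonvanishingExtension m (S i)) :
    NonvanishingExtension m (⋃ i ∈ s, S i) := by
  classical
  induction s using Finset.induction_on with
  | empty => exact fun A f _ hf hf0 => ⟨f, by simpa using hf, by simpa using hf0, fun _ _ => rfl⟩
  | insert i s _ ih =>
    rw [Finset.set_biUnion_insert]
    exact (h i (by simp)).union (hc i (by simp))
      (ih (fun j hj => hc j (by simp [hj])) fun j hj => h j (by simp [hj]))

lemma NonvanishingExtension.of_univ_subtype {X : Type*} [TopologicalSpace X] {m : ℕ} {S : Set X}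
    (hS : IsClosed S) (h : NonvanishingExtension m (univ : Set S)) :
    NonvanishingExtension m S := by
  classical
  intro A f hA hf hf0
  obtain ⟨g, hg, hg0, hgf⟩ := h (((↑) : S → X) ⁻¹' A) (fun x => f x) (hA.preimage continuous_subtype_val)
    (hf.comp continuous_subtype_val.continuousOn fun _ hx => hx) fun x hx => hf0 x hx
  rw [union_univ] at hg hg0
  set k : X → Fin m → ℝ := fun x => if hx : x ∈ S then g ⟨x, hx⟩ else f x with hk
  have hkS : S.domRestrict k = g := by
    funext x
    simp [hk]
  have hkf : EqOn k f A := by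
    intro x hx
    by_cases hxS : x ∈ S
    · simpa [hk, hxS] using hgf (x := ⟨x, hxS⟩) hx
    · simp [hk, hxS]
  refine ⟨k, ContinuousOn.union_of_isClosed (hf.congr hkf) ?_ hA hS, ?_, hkf⟩
  · rw [continuousOn_iff_continuous_domRestrict, hkS]
    exact continuousOn_univ.1 hg
  · rintro x (hx | hx)
    · rw [hkf hx]
      exact hf0 x hx
    · simpa [hk, hx] using hg0 ⟨x, hx⟩ trivial

lemma exists_continuous_eqOn.{u, v} {X : Type u} {Y : Type v} [TopologicalSpace X]
    [NormalSpace X] [TopologicalSpace Y] [TietzeExtension.{u, v} Y] {A : Set X} (hA : IsClosed A) {f : X → Y}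
    (hf : ContinuousOn f A) : ∃ g : X → Y, Continuous g ∧ EqOn g f A := by
  obtain ⟨g, hg⟩ := ContinuousMap.exists_restrict_eq hA
    ⟨A.domRestrict f, continuousOn_iff_continuous_domRestrict.1 hf⟩
  exact ⟨g, g.continuous, fun x hx => DFunLike.congr_fun hg ⟨x, hx⟩⟩

/-- A partition between the sets `{ε ≤ h}` and `{h ≤ 0}` can be found inside a finite union of
closed sets of smaller dimension. -/
lemma exists_isOpen_frontier_nonvanishingExtension {X : Type*} [TopologicalSpace X]
    [CompactSpace X] {m : ℕ}
    (hX : ∀ (x : X) (U : Set X), IsOpen U → x ∈ U →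
      ∃ V : Set X, IsOpen V ∧ x ∈ V ∧ V ⊆ U ∧ NonvanishingExtension m (frontier V))
    {C W : Set X} (hC : IsClosed C) (hW : IsOpen W) (hCW : C ⊆ W) :
    ∃ U S : Set X, IsOpen U ∧ C ⊆ U ∧ U ⊆ W ∧ frontier U ⊆ S ∧ NonvanishingExtension m S := by
  choose! V hVo hxV hVW hV using fun x => hX x W hW
  obtain ⟨t, htC, ht⟩ := hC.isCompact.elim_nhds_subcover V
    fun x hx => (hVo x (hCW hx)).mem_nhds (hxV x (hCW hx))
  have hUo : IsOpen (⋃ x ∈ t, V x) := isOpen_biUnion fun x hx => hVo x (hCW (htC x hx))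
  refine ⟨⋃ x ∈ t, V x, ⋃ x ∈ t, frontier (V x), hUo, ht,
    iUnion₂_subset fun x hx => hVW x (hCW (htC x hx)), ?_,
    .biUnion t (fun _ _ => isClosed_frontier) fun x hx => hV x (hCW (htC x hx))⟩
  intro x hx
  rw [hUo.frontier_eq, Finset.closure_biUnion] at hx
  obtain ⟨y, hy, hxy⟩ := mem_iUnion₂.1 hx.1
  refine mem_iUnion₂.2 ⟨y, hy, hxy, fun h => hx.2 (mem_iUnion₂.2 ⟨y, hy, interior_subset h⟩)⟩

lemma nonvanishingExtension_univ_succ {X : Type*} [TopologicalSpace X] [CompactSpace X]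
    [T2Space X] {m : ℕ}
    (hX : ∀ (x : X) (U : Set X), IsOpen U → x ∈ U →
      ∃ V : Set X, IsOpen V ∧ x ∈ V ∧ V ⊆ U ∧ NonvanishingExtension m (frontier V)) :
    NonvanishingExtension (m + 1) (univ : Set X) := by
  classical
  intro A f hA hf hf0
  obtain ⟨F, hF, hFf⟩ := exists_continuous_eqOn hA hf
  set h : X → ℝ := fun x => F x 0 with hh
  set T : X → Fin m → ℝ := fun x => Fin.tail (F x) with hT
  have hhc : Continuous h := (continuous_apply 0).comp hF
  have hTc : Continuous T := continuous_pi fun i => (continuous_apply i.succ).comp hF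
  have hne : ∀ x ∈ A, T x = 0 → h x ≠ 0 := by
    intro x hx hTx hhx
    refine hf0 x hx ?_
    rw [← hFf hx]
    funext i
    refine Fin.cases hhx (fun j => congrFun hTx j) i
  obtain ⟨ε, hε, hεh⟩ : ∃ ε > 0, ∀ x ∈ A, T x = 0 → ε < |h x| := by
    have hB : IsCompact (A ∩ T ⁻¹' {0}) := (hA.inter (isClosed_singleton.preimage hTc)).isCompact
    rcases (A ∩ T ⁻¹' {0}).eq_empty_or_nonempty with he | hne'
    · exact ⟨1, one_pos, fun x hx hTx => (he.subset (show x ∈ A ∩ T ⁻¹' {0} from ⟨hx, hTx⟩)).elim⟩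
    · obtain ⟨y, hy, hmin⟩ := hB.exists_isMinOn hne' hhc.abs.continuousOn
      have hpos : 0 < |h y| := abs_pos.2 (hne y hy.1 hy.2)
      exact ⟨|h y| / 2, by positivity,
        fun x hx hTx => (half_lt_self hpos).trans_le (hmin ⟨hx, hTx⟩)⟩
  obtain ⟨U, S, hU, hεU, hU0, hUS, hS⟩ := exists_isOpen_frontier_nonvanishingExtension hX
    (isClosed_le continuous_const hhc : IsClosed {x | ε ≤ h x})
    (isOpen_lt continuous_const hhc : IsOpen {x | 0 < h x}) fun x hx => hε.trans_le hx
  have hUA : ∀ x ∈ A, T x = 0 → x ∈ U → ε < h x := by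
    intro x hx hTx hxU
    have h1 := hεh x hx hTx
    rwa [abs_of_pos (hU0 hxU)] at h1
  have hUA' : ∀ x ∈ A, T x = 0 → x ∉ U → h x < -ε := by
    intro x hx hTx hxU
    rcases lt_abs.1 (hεh x hx hTx) with h1 | h1
    · exact absurd (hεU h1.le) hxU
    · linarith
  have hfrU : ∀ x ∈ frontier U, x ∉ U ∧ 0 ≤ h x := by
    intro x hx
    rw [hU.frontier_eq] at hx
    refine ⟨hx.2, ?_⟩
    exact closure_minimal (fun y hy => (hU0 hy).le) (isClosed_le continuous_const hhc) hx.1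
  obtain ⟨g, hg, hg0, hgT⟩ := hS (A ∩ frontier U) T (hA.inter isClosed_frontier)
    hTc.continuousOn (by
      intro x hx hTx
      have := hUA' x hx.1 hTx (hfrU x hx.2).1
      linarith [(hfrU x hx.2).2])
  have hglue : ∃ k : X → Fin m → ℝ, ContinuousOn k (A ∪ frontier U) ∧ EqOn k T A ∧
      EqOn k g (frontier U) := by
    refine ⟨fun x => if x ∈ A then T x else g x, ?_, fun x hx => by simp [hx], fun x hx => ?_⟩
    · refine ContinuousOn.union_of_isClosed (hTc.continuousOn.congr fun x hx => by simp [hx])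
        ((hg.mono (hUS.trans subset_union_right)).congr fun x hx => ?_) hA isClosed_frontier
      by_cases hxA : x ∈ A
      · simp [hxA, hgT ⟨hxA, hx⟩]
      · simp [hxA]
    · by_cases hxA : x ∈ A
      · simp [hxA, hgT ⟨hxA, hx⟩]
      · simp [hxA]
  obtain ⟨k, hk, hkT, hkg⟩ := hglue
  obtain ⟨G, hG, hGk⟩ := exists_continuous_eqOn (hA.union isClosed_frontier) hk
  have hGT : ∀ x ∈ A, G x = T x := fun x hx => (hGk (.inl hx)).trans (hkT hx)
  have hGfr : ∀ x ∈ frontier U, G x ≠ 0 := by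
    intro x hx
    rw [hGk (.inr hx), hkg hx]
    exact hg0 x (.inr (hUS hx))
  have hZ : IsClosed (G ⁻¹' {0}) := isClosed_singleton.preimage hG
  have hZU : IsClosed (G ⁻¹' {0} ∩ U) := by
    have : G ⁻¹' {0} ∩ U = G ⁻¹' {0} ∩ closure U := by
      refine (inter_subset_inter_right _ subset_closure).antisymm fun x hx => ⟨hx.1, ?_⟩
      by_contra hxU
      exact hGfr x (by rw [hU.frontier_eq]; exact ⟨hx.2, hxU⟩) hx.1
    rw [this]
    exact hZ.inter isClosed_closure
  have hZU' : IsClosed (G ⁻¹' {0} ∩ Uᶜ) := hZ.inter hU.isClosed_compl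
  set k₀ : X → ℝ := fun x => if x ∈ A then h x else if x ∈ U then max (h x) ε else min (h x) (-ε)
    with hk₀
  have hk₀A : EqOn k₀ h A := fun x hx => by simp [hk₀, hx]
  have hk₀U : EqOn k₀ (fun x => max (h x) ε) (G ⁻¹' {0} ∩ U) := by
    intro x hx
    by_cases hxA : x ∈ A
    · have := hUA x hxA ((hGT x hxA).symm.trans hx.1) hx.2
      simp [hk₀, hxA, this.le]
    · simp [hk₀, hxA, hx.2]
  have hk₀U' : EqOn k₀ (fun x => min (h x) (-ε)) (G ⁻¹' {0} ∩ Uᶜ) := by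
    intro x hx
    have hxU : x ∉ U := hx.2
    by_cases hxA : x ∈ A
    · have := hUA' x hxA ((hGT x hxA).symm.trans hx.1) hx.2
      simp [hk₀, hxA, this.le]
    · simp [hk₀, hxA, hxU]
  have hk₀c : ContinuousOn k₀ (A ∪ (G ⁻¹' {0} ∩ U ∪ G ⁻¹' {0} ∩ Uᶜ)) :=
    (hhc.continuousOn.congr hk₀A).union_of_isClosed
      (((hhc.max continuous_const).continuousOn.congr hk₀U).union_of_isClosed
        ((hhc.min continuous_const).continuousOn.congr hk₀U') hZU hZU') hA (hZU.union hZU')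
  obtain ⟨H, hH, hHk⟩ := exists_continuous_eqOn (hA.union (hZU.union hZU')) hk₀c
  refine ⟨fun x => Fin.cons (H x) (G x), ?_, ?_, ?_⟩
  · refine Continuous.continuousOn (continuous_pi fun i => ?_)
    refine Fin.cases ?_ (fun j => ?_) i
    · simpa using hH
    · simpa [Function.comp_def] using (continuous_apply j).comp hG
  · intro x _ hx
    have hGx : G x = 0 := by
      funext j
      simpa using congrFun hx j.succ
    have hHx : H x = 0 := by simpa using congrFun hx 0
    by_cases hxU : x ∈ U
    · have hxZ : x ∈ G ⁻¹' {0} ∩ U := ⟨hGx, hxU⟩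
      rw [hHk (.inr (.inl hxZ)), hk₀U hxZ] at hHx
      exact (hε.trans_le (le_max_right (h x) ε)).ne' hHx
    · have hxZ : x ∈ G ⁻¹' {0} ∩ Uᶜ := ⟨hGx, hxU⟩
      rw [hHk (.inr (.inr hxZ)), hk₀U' hxZ] at hHx
      linarith [min_le_right (h x) (-ε)]
  · intro x hx
    rw [← hFf hx]
    funext i
    refine Fin.cases ?_ (fun j => ?_) i
    · simp only [Fin.cons_zero]
      rw [hHk (.inl hx), hk₀A hx]
    · simp only [Fin.cons_succ]
      rw [hGT x hx]
      rfl

/-- Maps into `ℝᵐ ∖ {0}`, equivalently into the `(m - 1)`-sphere, extend from closed subsets of a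
compact space of dimension at most `m - 1`. -/
theorem nonvanishingExtension_of_indBelow {m : ℕ} {X : Type*} [TopologicalSpace X]
    [CompactSpace X] [T2Space X] (h : indBelow m X) :
    NonvanishingExtension m (univ : Set X) := by
  induction m generalizing X with
  | zero =>
    have : IsEmpty X := h
    exact fun A f _ _ _ => ⟨f, fun x => isEmptyElim x, fun x => isEmptyElim x,
      fun x => isEmptyElim x⟩
  | succ m ih =>
    refine nonvanishingExtension_univ_succ fun x U hU hx => ?_
    obtain ⟨V, hV, hxV, hVU, hfr⟩ := h x U hU hx
    have : CompactSpace (frontier V) := isCompact_iff_compactSpace.1 isClosed_frontier.isCompact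
    exact ⟨V, hV, hxV, hVU, .of_univ_subtype isClosed_frontier (ih hfr)⟩

/-- A compact Hausdorff space containing an `m`-dimensional cube has dimension at least `m`. -/
theorem not_indBelow_of_continuous_injOn_cube {m : ℕ} {X : Type*} [TopologicalSpace X]
    [CompactSpace X] [T2Space X] (e : (Fin m → ℝ) → X) (he : ContinuousOn e (Icc 0 1))
    (hinj : InjOn e (Icc 0 1)) : ¬ indBelow m X := by
  intro hX
  have hemb : Topology.IsClosedEmbedding ((Icc (0 : Fin m → ℝ) 1).domRestrict e) :=
    (continuousOn_iff_continuous_domRestrict.1 he).isClosedEmbedding (injOn_iff_injective.1 hinj)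
  obtain ⟨q, hq⟩ := ContinuousMap.exists_extension' hemb
    (⟨fun x i => 2 * (x : Fin m → ℝ) i - 1, continuous_pi fun i => (continuous_const.mul
      ((continuous_apply i).comp continuous_subtype_val)).sub continuous_const⟩ : C(Icc (0 : Fin m → ℝ) 1, Fin m → ℝ))
  have hqe : ∀ x ∈ Icc (0 : Fin m → ℝ) 1, q (e x) = fun i => 2 * x i - 1 :=
    fun x hx => congrFun hq ⟨x, hx⟩
  set B : Set (Fin m → ℝ) := Icc 0 1 ∩ ⋃ i, {x | x i = 0 ∨ x i = 1} with hB
  have hBc : IsCompact B := by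
    refine isCompact_Icc.inter_right (isClosed_iUnion_of_finite fun i => ?_)
    exact (isClosed_eq (continuous_apply i) continuous_const).union
      (isClosed_eq (continuous_apply i) continuous_const)
  obtain ⟨g, hg, hg0, hgq⟩ := nonvanishingExtension_of_indBelow hX (e '' B) q
    (hBc.image_of_continuousOn (he.mono inter_subset_left)).isClosed q.continuous.continuousOn (by
      rintro _ ⟨x, ⟨hx, hxB⟩, rfl⟩ h0
      obtain ⟨i, hi⟩ := mem_iUnion.1 hxB
      have := congrFun h0 i
      rw [hqe x hx] at this
      rcases hi with hi | hi <;> norm_num [hi] at this)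
  rw [union_univ] at hg hg0
  have hge : ∀ x ∈ B, g (e x) = fun i => 2 * x i - 1 := fun x hx =>
    (hgq ⟨x, hx, rfl⟩).trans (hqe x hx.1)
  obtain ⟨x, -, hx⟩ := exists_mem_cube_eq_zero (fun x => g (e x))
    (hg.comp he fun _ _ => mem_univ _)
    (by
      intro x hx i hi
      rw [hge x ⟨hx, mem_iUnion.2 ⟨i, .inl hi⟩⟩]
      norm_num [hi])
    (by
      intro x hx i hi
      rw [hge x ⟨hx, mem_iUnion.2 ⟨i, .inr hi⟩⟩]
      norm_num [hi])
  exact hg0 _ trivial hx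

lemma indBelow_of_isEmpty {X : Type*} [TopologicalSpace X] [IsEmpty X] (n : ℕ) :
    indBelow n X := by
  cases n with
  | zero => exact ‹IsEmpty X›
  | succ n => exact fun x => isEmptyElim x

/-- The preimages of spheres centered at `φ x` contain the frontiers of arbitrarily small
neighborhoods of `x`. -/
lemma Topology.IsEmbedding.exists_isOpen_frontier_subset_sphere {X V : Type*} [TopologicalSpace X]
    [PseudoMetricSpace V] {φ : X → V} (hφ : IsEmbedding φ) {x : X} {U : Set X} (hU : IsOpen U)
    (hx : x ∈ U) : ∃ W : Set X, ∃ s : ℝ, IsOpen W ∧ x ∈ W ∧ W ⊆ U ∧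
      ∀ y ∈ frontier W, dist (φ y) (φ x) = s := by
  obtain ⟨O, hO, rfl⟩ := hφ.isInducing.isOpen_iff.1 hU
  obtain ⟨s, hs, hsO⟩ := Metric.isOpen_iff.1 hO _ hx
  refine ⟨φ ⁻¹' ball (φ x) s, s, isOpen_ball.preimage hφ.continuous, mem_ball_self hs,
    preimage_mono hsO, fun y hy => ?_⟩
  exact frontier_ball_subset_sphere (hφ.continuous.frontier_preimage_subset _ hy)

lemma inner_sub_sub_eq_zero {V : Type*} [NormedAddCommGroup V] [InnerProductSpace ℝ V]
    {a b p c : V} (h : ‖a - c‖ = ‖b - c‖) (h' : dist a p = dist b p) :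
    inner ℝ (a - b) (p - c) = 0 := by
  have h1 := norm_sub_sq_real (a - c) (p - c)
  have h2 := norm_sub_sq_real (b - c) (p - c)
  rw [sub_sub_sub_cancel_right, ← dist_eq_norm] at h1 h2
  rw [← sub_sub_sub_cancel_right a b c, inner_sub_left]
  rw [h, h'] at h1
  linarith

lemma eq_of_inner_sub_sub_eq_zero {V : Type*} [NormedAddCommGroup V] [InnerProductSpace ℝ V]
    {a p c : V} (h : ‖a - c‖ = ‖p - c‖) (h' : inner ℝ (a - p) (p - c) = 0) : a = p := by
  have h1 := norm_add_sq_real (a - p) (p - c)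
  rw [sub_add_sub_cancel, h, h'] at h1
  have h2 : ‖a - p‖ ^ 2 = 0 := by linarith
  exact sub_eq_zero.1 (norm_eq_zero.1 (pow_eq_zero_iff two_ne_zero |>.1 h2))

/-- A subspace of a `k`-dimensional sphere has dimension at most `k`. -/
lemma indBelow_of_isEmbedding_sphere {V : Type*} [NormedAddCommGroup V] [InnerProductSpace ℝ V]
    [FiniteDimensional ℝ V] (k : ℕ) {X : Type*} [TopologicalSpace X] {φ : X → V}
    (hφ : IsEmbedding φ) (D : Submodule ℝ V) (c : V) (r : ℝ) (hr : ∀ x, ‖φ x - c‖ = r)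
    (hD : ∀ x y, ∀ d ∈ D, inner ℝ (φ x - φ y) d = 0)
    (hk : Module.finrank ℝ V ≤ Module.finrank ℝ D + k) : indBelow (k + 1) X := by
  induction k generalizing X D with
  | zero =>
    have hDtop : D = ⊤ := Submodule.eq_top_of_finrank_eq (D.finrank_le.antisymm hk)
    refine fun x U _ hx => ⟨univ, isOpen_univ, trivial, fun y _ => ?_, ?_⟩
    · rwa [hφ.injective (eq_of_inner_sub_sub_eq_zero ((hr y).trans (hr x).symm)
        (hD y x _ (hDtop ▸ trivial)))]
    · rw [frontier_univ]
      exact indBelow_of_isEmpty 0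
  | succ k ih =>
    intro x U hU hx
    by_cases hxD : φ x - c ∈ D
    · refine ⟨univ, isOpen_univ, trivial, fun y _ => ?_, ?_⟩
      · rwa [hφ.injective (eq_of_inner_sub_sub_eq_zero ((hr y).trans (hr x).symm) (hD y x _ hxD))]
      · rw [frontier_univ]
        exact indBelow_of_isEmpty _
    · obtain ⟨W, s, hW, hxW, hWU, hs⟩ := hφ.exists_isOpen_frontier_subset_sphere hU hx
      refine ⟨W, hW, hxW, hWU, ih (hφ.comp .subtypeVal) (D ⊔ Submodule.span ℝ {φ x - c})
        (fun y => hr y) (fun y z v hv => ?_) ?_⟩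
      · obtain ⟨d, hd, e, he, rfl⟩ := Submodule.mem_sup.1 hv
        obtain ⟨t, rfl⟩ := Submodule.mem_span_singleton.1 he
        have h1 : inner ℝ (φ y - φ z) (φ x - c) = 0 := inner_sub_sub_eq_zero
          ((hr y).trans (hr z).symm) ((hs y y.2).trans (hs z z.2).symm)
        simp [inner_add_right, inner_smul_right, h1, hD y z d hd]
      · have hlt : D < D ⊔ Submodule.span ℝ {φ x - c} := left_lt_sup.2 fun h =>
          hxD (h (Submodule.mem_span_singleton_self _))
        have := Submodule.finrank_lt_finrank_of_lt hlt
        omega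

lemma indBelow_of_isEmbedding {V : Type*} [NormedAddCommGroup V] [InnerProductSpace ℝ V]
    [FiniteDimensional ℝ V] {X : Type*} [TopologicalSpace X] {φ : X → V} (hφ : IsEmbedding φ) :
    indBelow (Module.finrank ℝ V + 2) X := by
  intro x U hU hx
  obtain ⟨W, s, hW, hxW, hWU, hs⟩ := hφ.exists_isOpen_frontier_subset_sphere hU hx
  refine ⟨W, hW, hxW, hWU, indBelow_of_isEmbedding_sphere _ (hφ.comp .subtypeVal) ⊥ (φ x) s
    (fun y => ?_) (fun y z d hd => ?_) (by simp)⟩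
  · simpa [dist_eq_norm] using hs y y.2
  · simp [(Submodule.mem_bot ℝ).1 hd]

/-- A compact subset of the Hilbert cube which is the union of the origin and of the cubes
`{x₀ = t}`, where the `i`-th coordinate ranges over an interval that degenerates for `i t ≥ 1`. -/
def cubeCone : Set (ℕ → ℝ) :=
  {x | x 0 ≤ 1 ∧ ∀ i, 0 ≤ x i ∧ x i ≤ x 0 * max 0 (1 - i * x 0)}

lemma isCompact_cubeCone : IsCompact cubeCone := by
  refine (isCompact_univ_pi fun _ : ℕ => isCompact_Icc (a := (0 : ℝ)) (b := 1)).of_isClosed_subset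
    ?_ fun x hx i _ => ⟨(hx.2 i).1, (hx.2 i).2.trans ?_⟩
  · have hc (i : ℕ) : Continuous fun x : ℕ → ℝ => x i := continuous_apply i
    simp only [cubeCone, ofPred_and, ofPred_forall]
    refine (isClosed_le (hc 0) continuous_const).inter (isClosed_iInter fun i => ?_)
    exact (isClosed_le continuous_const (hc i)).inter (isClosed_le (hc i)
      ((hc 0).mul (continuous_const.max (continuous_const.sub (continuous_const.mul (hc 0))))))
  · have h0 := (hx.2 0).1
    refine mul_le_one₀ hx.1 (le_max_left _ _) (max_le zero_le_one ?_)
    have : 0 ≤ (i : ℝ) * x 0 := by positivity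
    linarith

lemma eq_zero_of_mem_cubeCone {x : ℕ → ℝ} (hx : x ∈ cubeCone) {i : ℕ} (hi : 1 ≤ i * x 0) :
    x i = 0 := by
  have h := hx.2 i
  rw [max_eq_left (by linarith), mul_zero] at h
  exact h.2.antisymm h.1

lemma eq_zero_of_mem_cubeCone_of_zero {x : ℕ → ℝ} (hx : x ∈ cubeCone) (h0 : x 0 = 0) : x = 0 := by
  funext i
  have h := hx.2 i
  rw [h0, zero_mul] at h
  exact h.2.antisymm h.1

/-- An embedded `n`-dimensional cube in `cubeCone`. -/
noncomputable def cubeConeFace (n : ℕ) (z : Fin n → ℝ) (i : ℕ) : ℝ :=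
  if i = 0 then 1 / (n + 1)
  else if h : i - 1 < n then max 0 (min 1 (z ⟨i - 1, h⟩)) / (n + 1) ^ 2 else 0

lemma cubeConeFace_mem (n : ℕ) (z : Fin n → ℝ) : cubeConeFace n z ∈ cubeCone := by
  have hn : (0 : ℝ) < n + 1 := by positivity
  refine ⟨?_, fun i => ?_⟩
  · simp only [cubeConeFace, if_true]
    rw [div_le_one hn]
    linarith
  · simp only [cubeConeFace, if_true]
    split_ifs with hi h
    · subst hi
      exact ⟨by positivity, by simp⟩
    · refine ⟨by positivity, ?_⟩
      have hin : (i : ℝ) ≤ n := by exact_mod_cast show i ≤ n by omega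
      calc (max 0 (min 1 (z ⟨i - 1, h⟩)) / ((n : ℝ) + 1) ^ 2 : ℝ)
          ≤ 1 / ((n : ℝ) + 1) ^ 2 := by
            gcongr
            exact max_le zero_le_one (min_le_left _ _)
        _ = 1 / ((n : ℝ) + 1) * (1 - n * (1 / (n + 1))) := by
            field_simp
            ring
        _ ≤ 1 / ((n : ℝ) + 1) * max 0 (1 - i * (1 / ((n : ℝ) + 1))) := by
            gcongr
            refine le_max_of_le_right ?_
            gcongr
    · exact ⟨le_rfl, by positivity⟩

lemma continuous_cubeConeFace (n : ℕ) : Continuous (cubeConeFace n) := by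
  refine continuous_pi fun i => ?_
  simp only [cubeConeFace]
  split_ifs with hi h
  · exact continuous_const
  · exact (continuous_const.max (continuous_const.min (continuous_apply _))).div_const _
  · exact continuous_const

lemma injOn_cubeConeFace (n : ℕ) : InjOn (cubeConeFace n) (Icc 0 1) := by
  intro x hx y hy h
  funext i
  have hn : ((n : ℝ) + 1) ^ 2 ≠ 0 := by positivity
  have := congrFun h (i + 1)
  have hx1 := hx.2 i
  have hy1 := hy.2 i
  have hx0 := hx.1 i
  have hy0 := hy.1 i
  simp only [Pi.zero_apply, Pi.one_apply] at hx0 hx1 hy0 hy1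
  simpa [cubeConeFace, div_left_inj' hn, hx0, hx1, hy0, hy1] using this

lemma exists_indBelow_of_isClosed {A : Set cubeCone} (hA : IsClosed A)
    (h0 : ∀ x ∈ A, (x : ℕ → ℝ) ≠ 0) : ∃ n, indBelow n A := by
  have : CompactSpace cubeCone := isCompact_iff_compactSpace.1 isCompact_cubeCone
  have : CompactSpace A := isCompact_iff_compactSpace.1 hA.isCompact
  have hc (i : ℕ) : Continuous fun x : A => (x : ℕ → ℝ) i :=
    (continuous_apply i).comp (continuous_subtype_val.comp continuous_subtype_val)
  rcases isEmpty_or_nonempty A with hE | hE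
  · exact ⟨0, indBelow_of_isEmpty 0⟩
  obtain ⟨p, -, hp⟩ := isCompact_univ.exists_isMinOn univ_nonempty (hc 0).continuousOn
  have hp0 : 0 < (p : ℕ → ℝ) 0 := (p.1.2.2 0).1.lt_of_ne fun h =>
    h0 p p.2 (eq_zero_of_mem_cubeCone_of_zero p.1.2 h.symm)
  obtain ⟨N, hN⟩ := exists_nat_ge (1 / (p : ℕ → ℝ) 0)
  have hzero : ∀ (x : A) (i : ℕ), N ≤ i → (x : ℕ → ℝ) i = 0 := by
    intro x i hi
    refine eq_zero_of_mem_cubeCone x.1.2 (((div_le_iff₀ hp0).1 hN).trans ?_)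
    have := hp (mem_univ x)
    gcongr
    exact this
  set φ : A → EuclideanSpace ℝ (Fin N) := fun x => WithLp.toLp 2 fun i => (x : ℕ → ℝ) i with hφ
  have hφc : Continuous φ := (PiLp.continuous_toLp 2 _).comp (continuous_pi fun i => hc i)
  have hφi : Function.Injective φ := by
    intro x y h
    refine Subtype.ext (Subtype.ext (funext fun i => ?_))
    rcases lt_or_ge i N with hi | hi
    · exact congrArg (fun v => v ⟨i, hi⟩) h
    · rw [hzero x i hi, hzero y i hi]
  exact ⟨_, indBelow_of_isEmbedding (hφc.isClosedEmbedding hφi).isEmbedding⟩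

lemma tdim_lt_top {X : Type*} [MetricSpace X] {A : Set X} (h : ∃ n, indBelow n A) :
    tdim A < ⊤ := by
  obtain ⟨n, hn⟩ := h
  have hle : tdim A ≤ (n : EReal) - 1 := sInf_le ⟨n, hn, rfl⟩
  have hn1 : (n : EReal) - 1 = ((n - 1 : ℝ) : EReal) := by simp
  exact (hle.trans_eq hn1).trans_lt (EReal.coe_lt_top _)

lemma tdim_eq_top {X : Type*} [MetricSpace X] {A : Set X} (h : ∀ n, ¬ indBelow n A) :
    tdim A = ⊤ :=
  sInf_eq_top.2 fun _ ⟨n, hn, _⟩ => (h n hn).elim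

/-- A compact metric space of infinite topological dimension such that every continuous map to
`ℝⁿ` has at most one fiber of infinite topological dimension. -/
theorem stmt16 :
    ∃ (K : Type) (_ : MetricSpace K), CompactSpace K ∧
      tdim (Set.univ : Set K) = ⊤ ∧
      ∀ n : ℕ, 0 < n → ∀ f : C(K, Fin n → ℝ),
        ∃ yf : Fin n → ℝ, ∀ y : Fin n → ℝ, y ≠ yf → tdim (⇑f ⁻¹' {y}) < ⊤ := by
  let _ : MetricSpace cubeCone := TopologicalSpace.metrizableSpaceMetric cubeCone
  have hK : CompactSpace cubeCone := isCompact_iff_compactSpace.1 isCompact_cubeCone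
  refine ⟨cubeCone, inferInstance, hK, tdim_eq_top fun n => ?_, fun n _ f => ?_⟩
  · have hU : CompactSpace (univ : Set cubeCone) := isCompact_iff_compactSpace.1 isCompact_univ
    refine not_indBelow_of_continuous_injOn_cube
      (fun z => ⟨⟨cubeConeFace n z, cubeConeFace_mem n z⟩, trivial⟩)
      (((continuous_cubeConeFace n).subtype_mk _).subtype_mk _).continuousOn
      fun x hx y hy h => injOn_cubeConeFace n hx hy ?_
    exact congrArg (fun v => v.1.1) h
  · have h0 : (0 : ℕ → ℝ) ∈ cubeCone := ⟨zero_le_one, fun i => by simp⟩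
    refine ⟨f ⟨0, h0⟩, fun y hy => tdim_lt_top (exists_indBelow_of_isClosed
      (isClosed_singleton.preimage f.continuous) ?_)⟩
    rintro ⟨x, hx⟩ rfl (rfl : x = 0)
    exact hy rfl
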